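/- arXiv:1812.09200 — 2 statements merged into one kernel-verified Lean document; each statement's English description precedes it below -/
import Mathlib

section
/- (Theorem 3.2, part 1) Let m, α ∈ ℝ and W ∈ C²(ℝ). The uniform state φ_* = m is a stable critical point of 𝓕 over H²_m(𝕋^N) — i.e., the second variation ∇²𝓕(m)(u,u) = ∫_{𝕋^N} ( (αu + Δu)² + W''(m) u² ) dx is nonnegative for every u ∈ H²(𝕋^N) with ∫_{𝕋^N} u dx = 0 — if and only if W''(m) + min_{k ∈ 2πℤ^N, k ≠ 0} (α − |k|²)² ≥ 0. -/
open MeasureTheory Filter Real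

noncomputable section

abbrev Pt (N : ℕ) := Fin N → ℝ

/-- partial derivative in direction `i` -/
def pd {N : ℕ} (i : Fin N) (f : Pt N → ℝ) (x : Pt N) : ℝ := fderiv ℝ f x (Pi.single i 1)

/-- second partial derivative ∂ᵢ∂ⱼ -/
def pd2 {N : ℕ} (i j : Fin N) (f : Pt N → ℝ) : Pt N → ℝ := pd i (pd j f)

/-- the unit cube [0,1]^N, fundamental domain of the torus 𝕋^N -/
def cube (N : ℕ) : Set (Pt N) := Set.Icc 0 1

/-- Laplacian on the torus -/
def lap {N : ℕ} (f : Pt N → ℝ) (x : Pt N) : ℝ := ∑ i, pd2 i i f x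

/-- |∇f|² -/
def gradSq {N : ℕ} (f : Pt N → ℝ) (x : Pt N) : ℝ := ∑ i, (pd i f x)^2

/-- 1-periodicity in each coordinate: a function on the torus 𝕋^N -/
def ZPeriodic {N : ℕ} (f : Pt N → ℝ) : Prop :=
  ∀ (x : Pt N) (i : Fin N), f (x + Pi.single i 1) = f x

/-- min_{k ∈ 2πℤ^N, k ≠ 0} (α - |k|²)² -/
def freqMinPFC (N : ℕ) (α : ℝ) : ℝ :=
  sInf {t : ℝ | ∃ k : Fin N → ℤ, k ≠ 0 ∧ t = (α - 4*π^2 * ∑ i, ((k i : ℝ))^2)^2}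

/-- admissible test functions in the definition of P_N -/
def AdmissibleP {N : ℕ} (u : Pt N → ℝ) : Prop :=
  ContDiff ℝ 2 u ∧ ZPeriodic u ∧
    (∫ x in cube N, (u x)^3) = 1 ∧ (∫ x in cube N, u x) = 0

/-- the product (∫ (αu+Δu)² + c u²) · (∫ u⁴) -/
def Penergy {N : ℕ} (α c : ℝ) (u : Pt N → ℝ) : ℝ :=
  (∫ x in cube N, ((α * u x + lap u x)^2 + c * (u x)^2)) * (∫ x in cube N, (u x)^4)

/-- the optimal constant P_N (with c = W''(m)) -/
def PN (N : ℕ) (α c : ℝ) : ℝ :=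
  sInf {p : ℝ | ∃ u : Pt N → ℝ, AdmissibleP u ∧ p = Penergy α c u}

/-- membership in H²_m(𝕋^N) -/
def MemH2m {N : ℕ} (m : ℝ) (φ : Pt N → ℝ) : Prop :=
  ContDiff ℝ 2 φ ∧ ZPeriodic φ ∧ (∫ x in cube N, φ x) = m

/-- the PFC functional 𝓕 on the torus -/
def Fen {N : ℕ} (α : ℝ) (W : ℝ → ℝ) (φ : Pt N → ℝ) : ℝ :=
  ∫ x in cube N, ((1/2) * (α * φ x + lap φ x)^2 + W (φ x))

section helpers

open UnitAddTorus

local instance msUAC : MeasureSpace UnitAddCircle := ⟨AddCircle.haarAddCircle⟩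

local instance haarUAC : Measure.IsAddHaarMeasure (volume : Measure UnitAddCircle) :=
  inferInstanceAs (Measure.IsAddHaarMeasure AddCircle.haarAddCircle)

local instance probUAC : IsProbabilityMeasure (volume : Measure UnitAddCircle) :=
  inferInstanceAs (IsProbabilityMeasure AddCircle.haarAddCircle)

/-- periodicity for functions with arbitrary values -/
def PerC {N : ℕ} {E : Type*} (f : Pt N → E) : Prop :=
  ∀ (x : Pt N) (i : Fin N), f (x + Pi.single i 1) = f x

lemma PerC.int {N : ℕ} {E : Type*} {f : Pt N → E} (hf : PerC f) (n : Fin N → ℤ) (x : Pt N) :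
    f (x + fun i => (n i : ℝ)) = f x := by
  let S : AddSubgroup (Pt N) :=
    { carrier := {v | ∀ x, f (x + v) = f x}
      zero_mem' := by intro x; simp
      add_mem' := by
        intro a b ha hb x
        rw [← add_assoc, hb, ha]
      neg_mem' := by
        intro a ha x
        have := ha (x + -a)
        rw [← this]; simp }
  have h1 : (fun i => (n i : ℝ)) = ∑ i, n i • (Pi.single i 1 : Pt N) := by
    ext j
    simp [Finset.sum_apply, Pi.single_apply]
  have h2 : (fun i => (n i : ℝ)) ∈ S := by
    rw [h1]
    exact S.sum_mem fun i _ => S.zsmul_mem (fun x => hf x i) _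
  exact h2 x

lemma exists_lift {N : ℕ} {g : Pt N → ℂ} (hg : Continuous g) (hp : PerC g) :
    ∃ G : C(UnitAddTorus (Fin N), ℂ), ∀ x : Pt N, G (fun i => (x i : UnitAddCircle)) = g x := by
  let p : C(Pt N, UnitAddTorus (Fin N)) :=
    ⟨fun x i => (x i : UnitAddCircle), by
      refine continuous_pi fun i => ?_
      exact (AddCircle.continuous_mk' 1).comp (continuous_apply i)⟩
  have hq : Topology.IsQuotientMap p := by
    have : IsOpenQuotientMap (Pi.map (fun (_ : Fin N) (y : ℝ) => (y : UnitAddCircle))) :=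
      IsOpenQuotientMap.piMap fun i => QuotientAddGroup.isOpenQuotientMap_mk
    exact this.isQuotientMap
  have hF : Function.FactorsThrough (⟨g, hg⟩ : C(Pt N, ℂ)) p := by
    intro a b hab
    have : ∀ i, ∃ n : ℤ, a i = b i + n := by
      intro i
      have h := congrFun hab i
      change ((a i : ℝ) : UnitAddCircle) = (b i : UnitAddCircle) at h
      have h' := (QuotientAddGroup.eq).1 h
      obtain ⟨n, hn⟩ := AddSubgroup.mem_zmultiples_iff.1 h'
      refine ⟨-n, ?_⟩
      simp at hn
      push_cast
      linarith
    choose n hn using this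
    have : a = b + fun i => (n i : ℝ) := funext hn
    change g a = g b
    rw [this, hp.int]
  refine ⟨hq.lift ⟨g, hg⟩ hF, ?_⟩
  · intro x
    have := hq.lift_comp ⟨g, hg⟩ hF
    exact congrArg (fun F => F x) this

lemma integral_torus {N : ℕ} {E : Type*} [NormedAddCommGroup E] [NormedSpace ℝ E]
    (f : UnitAddTorus (Fin N) → E) :
    ∫ t, f t = ∫ x in cube N, f (fun i => (x i : UnitAddCircle)) := by
  rw [UnitAddTorus.integral_preimage f 0]
  apply setIntegral_congr_set
  have h := Measure.univ_pi_Ioc_ae_eq_Icc (μ := fun _ : Fin N => (volume : Measure ℝ))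
    (f := 0) (g := 1)
  have : {x : Fin N → ℝ | ∀ i, x i ∈ Set.Ioc ((0 : Fin N → ℝ) i) ((0 : Fin N → ℝ) i + 1)} =
      Set.univ.pi fun i => Set.Ioc ((0 : Fin N → ℝ) i) ((1 : Fin N → ℝ) i) := by
    ext x; simp
  rw [this]
  exact h

/-- exponentials -/
def Ex {N : ℕ} (k : Fin N → ℤ) (x : Pt N) : ℂ :=
  Complex.exp (-(2 * π * Complex.I) * ((∑ i, (k i : ℝ) * x i : ℝ) : ℂ))

lemma mFourier_Ex {N : ℕ} (k : Fin N → ℤ) (x : Pt N) :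
    mFourier (-k) (fun i => (x i : UnitAddCircle)) = Ex k x := by
  simp only [mFourier, ContinuousMap.coe_mk, fourier_coe_apply, Ex]
  rw [← Complex.exp_sum]
  congr 1
  push_cast
  rw [Finset.mul_sum]
  apply Finset.sum_congr rfl
  intro i _
  simp
  ring

lemma parseval {N : ℕ} {g : Pt N → ℝ} (hg : Continuous g) (hp : PerC g) :
    HasSum (fun k : Fin N → ℤ => ‖∫ x in cube N, Ex k x * (g x : ℂ)‖ ^ 2)
      (∫ x in cube N, g x ^ 2) := by
  obtain ⟨G, hG⟩ := exists_lift (g := fun x => (g x : ℂ)) (by fun_prop)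
    (fun x i => by simp only [hp x i])
  have h := hasSum_sq_mFourierCoeff (G.toLp 2 volume ℂ)
  simp only [mFourierCoeff_toLp] at h
  have e : ∫ t, ‖(G.toLp 2 volume ℂ : Lp ℂ 2 volume) t‖ ^ 2 = ∫ x in cube N, g x ^ 2 := by
    rw [integral_congr_ae (g := fun t => ‖G t‖ ^ 2), integral_torus]
    · simp [hG]
    · filter_upwards [G.coeFn_toLp (p := 2) (𝕜 := ℂ) volume] with t ht
      rw [ht]
  rw [e] at h
  convert h using 4 with k
  rw [mFourierCoeff, integral_torus]
  simp [hG, mFourier_Ex]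

end helpers

lemma cube_compact (N : ℕ) : IsCompact (cube N) := isCompact_Icc

lemma intOn {N : ℕ} {E : Type*} [NormedAddCommGroup E] {f : Pt N → E} (hf : Continuous f) :
    IntegrableOn f (cube N) := hf.continuousOn.integrableOn_compact (cube_compact N)

lemma integral_fderiv_zero {N : ℕ} {E : Type*} [NormedAddCommGroup E] [NormedSpace ℝ E]
    [CompleteSpace E] {h : Pt N → E} (hh : ContDiff ℝ 1 h) (hp : PerC h) (i : Fin N) :
    ∫ x in cube N, fderiv ℝ h x (Pi.single i 1) = 0 := by
  obtain _ | n := N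
  · exact i.elim0
  have hc : Continuous fun x => fderiv ℝ h x (Pi.single i 1) :=
    (hh.continuous_fderiv (by norm_num)).clm_apply continuous_const
  have key := integral_divergence_of_hasFDerivAt_off_countable' (E := E) (0 : Pt (n+1)) 1
    (fun j => zero_le_one)
    (fun j => if j = i then h else 0) (fun j x => if j = i then fderiv ℝ h x else 0) ∅
    Set.countable_empty
    (fun j => by
      split_ifs
      · exact hh.continuous.continuousOn
      · exact continuousOn_const)
    (fun x _ j => by
      split_ifs
      · exact (hh.differentiable (by norm_num) x).hasFDerivAt
      · exact hasFDerivAt_const _ _)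
  have es : ∀ x, ∑ j, (if j = i then fderiv ℝ h x else 0) (Pi.single j 1)
      = fderiv ℝ h x (Pi.single i 1) := by
    intro x
    rw [Finset.sum_eq_single i]
    · simp
    · intro j _ hj; simp [hj]
    · simp
  simp only [es] at key
  rw [cube, key (intOn hc), Finset.sum_eq_single i]
  · simp only [if_true]
    rw [sub_eq_zero]
    congr 1
    ext y
    rw [← hp (i.insertNth ((0 : Pt (n+1)) i) y) i]
    congr 1
    ext j
    refine Fin.succAboveCases i ?_ (fun j => ?_) j <;> simp
  · intro j _ hj; simp [hj]
  · simp

/-- the linear form `x ↦ k · x` -/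
def Lk {N : ℕ} (k : Fin N → ℤ) : Pt N →L[ℝ] ℝ :=
  ∑ i, (k i : ℝ) • ContinuousLinearMap.proj (R := ℝ) (φ := fun _ : Fin N => ℝ) i

lemma Lk_apply {N : ℕ} (k : Fin N → ℤ) (x : Pt N) : Lk k x = ∑ i, (k i : ℝ) * x i := by
  simp [Lk]

lemma Lk_single {N : ℕ} (k : Fin N → ℤ) (i : Fin N) : Lk k (Pi.single i 1) = k i := by
  simp [Lk_apply, Pi.single_apply]

lemma Ex_eq {N : ℕ} (k : Fin N → ℤ) :
    Ex k = fun x => Complex.exp (-(2 * π * Complex.I) * ((Lk k x : ℝ) : ℂ)) := by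
  ext x; rw [Ex, Lk_apply]

lemma Ex_contDiff {N : ℕ} (k : Fin N → ℤ) : ContDiff ℝ 2 (Ex k) := by
  rw [Ex_eq]
  have : ContDiff ℝ 2 fun x => ((Lk k x : ℝ) : ℂ) :=
    Complex.ofRealCLM.contDiff.comp (Lk k).contDiff
  exact (contDiff_const.mul this).cexp

lemma Ex_per {N : ℕ} (k : Fin N → ℤ) : PerC (Ex k) := by
  intro x i
  simp only [Ex_eq, map_add, Lk_single]
  rw [Complex.exp_eq_exp_iff_exists_int]
  refine ⟨-k i, ?_⟩
  push_cast
  ring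

lemma Ex_fderiv {N : ℕ} (k : Fin N → ℤ) (x : Pt N) (i : Fin N) :
    fderiv ℝ (Ex k) x (Pi.single i 1) = -(2 * π * Complex.I * k i) * Ex k x := by
  have h0 : HasFDerivAt (fun x => ((Lk k x : ℝ) : ℂ)) (Complex.ofRealCLM.comp (Lk k)) x :=
    (Complex.ofRealCLM.comp (Lk k)).hasFDerivAt
  have h1 := (h0.const_mul (-(2 * π * Complex.I))).cexp
  rw [Ex_eq, h1.fderiv]
  simp [Lk_single]
  ring

lemma pd_per {N : ℕ} {f : Pt N → ℝ} (hp : PerC f) (i : Fin N) : PerC (pd i f) := by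
  intro x j
  have : f = fun y => f (y + Pi.single j 1) := by ext y; rw [hp]
  simp only [pd]
  conv_rhs => rw [this]
  rw [fderiv_comp_add_right]

lemma pd_contDiff {N : ℕ} {f : Pt N → ℝ} {n m : WithTop ℕ∞} (hf : ContDiff ℝ n f)
    (hm : m + 1 ≤ n) (i : Fin N) : ContDiff ℝ m (pd i f) :=
  (hf.fderiv_right hm).clm_apply contDiff_const

lemma ibp {N : ℕ} {f : Pt N → ℝ} (hf : ContDiff ℝ 1 f) (hp : PerC f) (k : Fin N → ℤ)
    (i : Fin N) :
    ∫ x in cube N, Ex k x * (pd i f x : ℂ) =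
      (2 * π * Complex.I * k i) * ∫ x in cube N, Ex k x * (f x : ℂ) := by
  have hE : ContDiff ℝ 1 (Ex k) := (Ex_contDiff k).of_le (by norm_num)
  have hfc : ContDiff ℝ 1 fun x => (f x : ℂ) := Complex.ofRealCLM.contDiff.comp hf
  have h0 := integral_fderiv_zero (h := fun x => Ex k x * (f x : ℂ)) (hE.mul hfc)
    (fun x j => by simp only [hp x j, Ex_per k x j]) i
  have e : ∀ x, fderiv ℝ (fun x => Ex k x * (f x : ℂ)) x (Pi.single i 1) =
      Ex k x * (pd i f x : ℂ) - (2 * π * Complex.I * k i) * (Ex k x * (f x : ℂ)) := by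
    intro x
    have a1 := (hE.differentiable (by norm_num) x).hasFDerivAt
    have a2 : HasFDerivAt (fun x => (f x : ℂ)) (Complex.ofRealCLM.comp (fderiv ℝ f x)) x :=
      Complex.ofRealCLM.hasFDerivAt.comp x (hf.differentiable (by norm_num) x).hasFDerivAt
    have a3 : HasFDerivAt (fun x => Ex k x * (f x : ℂ)) _ x := a1.mul a2
    rw [a3.fderiv]
    simp [Ex_fderiv, pd]
    ring
  simp only [e] at h0
  have c1 : Continuous fun x => Ex k x * (pd i f x : ℂ) :=
    hE.continuous.mul (Complex.continuous_ofReal.comp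
      (pd_contDiff (m := 0) hf (by norm_num) i).continuous)
  have c2 : Continuous fun x => Ex k x * (f x : ℂ) := hE.continuous.mul hfc.continuous
  rw [integral_sub (intOn c1) ((intOn c2).const_mul _), integral_const_mul, sub_eq_zero] at h0
  exact h0

lemma ibp2 {N : ℕ} {f : Pt N → ℝ} (hf : ContDiff ℝ 2 f) (hp : PerC f) (k : Fin N → ℤ) (α : ℝ) :
    ∫ x in cube N, Ex k x * ((α * f x + lap f x : ℝ) : ℂ) =
      ((α - 4 * π ^ 2 * ∑ i, (k i : ℝ) ^ 2 : ℝ) : ℂ) * ∫ x in cube N, Ex k x * (f x : ℂ) := by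
  have hE := (Ex_contDiff k).continuous
  have c2 : ∀ i, Continuous (pd2 i i f) := fun i =>
    (pd_contDiff (m := 0) (pd_contDiff (m := 1) hf (by norm_num) i) (by norm_num) i).continuous
  have e : ∀ x, Ex k x * ((α * f x + lap f x : ℝ) : ℂ) =
      α * (Ex k x * (f x : ℂ)) + ∑ i, Ex k x * (pd2 i i f x : ℂ) := by
    intro x
    simp only [lap]
    push_cast
    rw [← Finset.mul_sum]
    ring
  have i1 : IntegrableOn (fun x => (α : ℂ) * (Ex k x * (f x : ℂ))) (cube N) :=
    (intOn (hE.mul (Complex.continuous_ofReal.comp hf.continuous))).const_mul _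
  have i2 : ∀ i, IntegrableOn (fun x => Ex k x * (pd2 i i f x : ℂ)) (cube N) := fun i =>
    intOn (hE.mul (Complex.continuous_ofReal.comp (c2 i)))
  simp only [e]
  rw [integral_add i1 (integrable_finsetSum _ fun i _ => i2 i), integral_const_mul,
    integral_finsetSum _ fun i _ => i2 i]
  have e2 : ∀ i, ∫ x in cube N, Ex k x * (pd2 i i f x : ℂ) =
      -(4 * π ^ 2 * (k i : ℂ) ^ 2) * ∫ x in cube N, Ex k x * (f x : ℂ) := by
    intro i
    rw [pd2, ibp (pd_contDiff hf (by norm_num) i) (pd_per hp i),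
      ibp (hf.of_le (by norm_num)) hp]
    linear_combination (4 * π ^ 2 * (k i : ℂ) ^ 2 * ∫ x in cube N, Ex k x * (f x : ℂ)) *
      Complex.I_sq
  simp only [e2]
  rw [← Finset.sum_mul]
  push_cast
  rw [Finset.sum_neg_distrib, ← Finset.mul_sum]
  ring

lemma lap_continuous {N : ℕ} {f : Pt N → ℝ} (hf : ContDiff ℝ 2 f) : Continuous (lap f) :=
  continuous_finsetSum _ fun i _ =>
    (pd_contDiff (m := 0) (pd_contDiff (m := 1) hf (by norm_num) i) (by norm_num) i).continuous

lemma lap_per {N : ℕ} {f : Pt N → ℝ} (hp : PerC f) : PerC (lap f) := by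
  intro x j
  simp only [lap, pd2]
  exact Finset.sum_congr rfl fun i _ => pd_per (pd_per hp i) i x j

lemma freqMin_le {N : ℕ} (α : ℝ) {k : Fin N → ℤ} (hk : k ≠ 0) :
    freqMinPFC N α ≤ (α - 4*π^2 * ∑ i, ((k i : ℝ))^2)^2 := by
  apply csInf_le
  · exact ⟨0, by rintro t ⟨k, -, rfl⟩; positivity⟩
  · exact ⟨k, hk, rfl⟩

lemma energy_split {N : ℕ} {u : Pt N → ℝ} (hu : ContDiff ℝ 2 u) (α c : ℝ) :
    ∫ x in cube N, ((α * u x + lap u x)^2 + c * (u x)^2) =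
      (∫ x in cube N, (α * u x + lap u x)^2) + c * ∫ x in cube N, (u x)^2 := by
  have h1 := hu.continuous
  have h2 := lap_continuous hu
  rw [integral_add (intOn (by fun_prop)) (intOn (by fun_prop)), integral_const_mul]

lemma backward {N : ℕ} {u : Pt N → ℝ} (hu : ContDiff ℝ 2 u) (hp : PerC u)
    (h0 : ∫ x in cube N, u x = 0) (α : ℝ) :
    freqMinPFC N α * ∫ x in cube N, (u x)^2 ≤ ∫ x in cube N, (α * u x + lap u x)^2 := by
  have h1 := hu.continuous
  have h2 := lap_continuous hu
  have A := (parseval h1 hp).mul_left (freqMinPFC N α)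
  have B := parseval (g := fun x => α * u x + lap u x) (by fun_prop)
    (fun x i => by simp only [hp x i, lap_per hp x i])
  refine hasSum_le (fun k => ?_) A B
  rw [ibp2 hu hp, norm_mul, mul_pow, Complex.norm_real, Real.norm_eq_abs, sq_abs]
  by_cases hk : k = 0
  · subst hk
    have : ∫ x in cube N, Ex 0 x * (u x : ℂ) = 0 := by
      simp only [Ex, Pi.zero_apply, Int.cast_zero, zero_mul, Finset.sum_const_zero,
        Complex.ofReal_zero, mul_zero, Complex.exp_zero, one_mul]
      rw [integral_complex_ofReal, h0, Complex.ofReal_zero]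
    simp [this]
  · exact mul_le_mul_of_nonneg_right (freqMin_le α hk) (by positivity)

/-- test function -/
def cosk {N : ℕ} (k : Fin N → ℤ) (x : Pt N) : ℝ := Real.cos (2 * π * Lk k x)

/-- auxiliary test function -/
def sink {N : ℕ} (k : Fin N → ℤ) (x : Pt N) : ℝ := Real.sin (2 * π * Lk k x)

lemma cosk_contDiff {N : ℕ} (k : Fin N → ℤ) : ContDiff ℝ 2 (cosk k) :=
  (contDiff_const.mul (Lk k).contDiff).cos

lemma sink_contDiff {N : ℕ} (k : Fin N → ℤ) : ContDiff ℝ 2 (sink k) :=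
  (contDiff_const.mul (Lk k).contDiff).sin

lemma cosk_per {N : ℕ} (k : Fin N → ℤ) : PerC (cosk k) := by
  intro x i
  rw [cosk, cosk, map_add, Lk_single, mul_add, mul_comm (2 * π) (k i : ℝ),
    Real.cos_add_int_mul_two_pi]

lemma sink_per {N : ℕ} (k : Fin N → ℤ) : PerC (sink k) := by
  intro x i
  rw [sink, sink, map_add, Lk_single, mul_add, mul_comm (2 * π) (k i : ℝ),
    Real.sin_add_int_mul_two_pi]

lemma pd_cosk {N : ℕ} (k : Fin N → ℤ) (i : Fin N) :
    pd i (cosk k) = fun x => -(2 * π * k i) * sink k x := by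
  ext x
  have h := ((Lk k).hasFDerivAt (x := x).const_mul (2 * π)).cos
  rw [pd]
  unfold cosk
  rw [h.fderiv]
  simp [Lk_single, sink]
  ring

lemma pd_sink {N : ℕ} (k : Fin N → ℤ) (i : Fin N) :
    pd i (sink k) = fun x => (2 * π * k i) * cosk k x := by
  ext x
  have h := ((Lk k).hasFDerivAt (x := x).const_mul (2 * π)).sin
  rw [pd]
  unfold sink
  rw [h.fderiv]
  simp [Lk_single, cosk]
  ring

lemma lap_cosk {N : ℕ} (k : Fin N → ℤ) (x : Pt N) :
    lap (cosk k) x = -(4 * π ^ 2 * ∑ i, (k i : ℝ) ^ 2) * cosk k x := by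
  have : ∀ i, pd2 i i (cosk k) x = -(4 * π ^ 2 * (k i : ℝ) ^ 2) * cosk k x := by
    intro i
    rw [pd2, pd_cosk, pd, fderiv_const_mul ((sink_contDiff k).differentiable (by norm_num) x)]
    have := congrFun (pd_sink k i) x
    rw [pd] at this
    simp [this]
    ring
  simp only [lap, this]
  rw [← Finset.sum_mul, Finset.sum_neg_distrib, ← Finset.mul_sum]

lemma integral_cosk {N : ℕ} {k : Fin N → ℤ} (hk : k ≠ 0) : ∫ x in cube N, cosk k x = 0 := by
  obtain ⟨i, hi⟩ := Function.ne_iff.1 hk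
  have h := integral_fderiv_zero ((sink_contDiff k).of_le (by norm_num)) (sink_per k) i
  have e : ∀ x, fderiv ℝ (sink k) x (Pi.single i 1) = (2 * π * k i) * cosk k x :=
    fun x => congrFun (pd_sink k i) x
  simp only [e] at h
  rw [integral_const_mul] at h
  have : (k i : ℝ) ≠ 0 := by exact_mod_cast hi
  rcases mul_eq_zero.1 h with h | h
  · exfalso
    have : (2 * π * k i : ℝ) ≠ 0 := by positivity
    exact this h
  · exact h

lemma integral_cosk_sq {N : ℕ} {k : Fin N → ℤ} (hk : k ≠ 0) :
    ∫ x in cube N, cosk k x ^ 2 = 1 / 2 := by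
  have hk2 : k + k ≠ 0 := by
    intro h
    apply hk
    ext i
    have := congrFun h i
    simp at this
    simp; omega
  have e : ∀ x, cosk k x ^ 2 = 1 / 2 + 1 / 2 * cosk (k + k) x := by
    intro x
    have : Lk (k + k) x = 2 * Lk k x := by
      simp only [Lk_apply, Finset.mul_sum]
      apply Finset.sum_congr rfl
      intro i _
      simp; ring
    rw [cosk, cosk, this, Real.cos_sq]
    ring_nf
  simp only [e]
  rw [integral_add (intOn continuous_const)
    ((intOn (cosk_contDiff _).continuous).const_mul _), integral_const_mul,
    integral_cosk hk2]
  simp [cube, Real.volume_Icc_pi, Measure.real]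

/-- Theorem 3.2, part 1: stability of the uniform state m iff
W''(m) + min_{k ∈ 2πℤ^N \ {0}} (α - |k|²)² ≥ 0. -/
theorem uniform_state_stable_iff (N : ℕ) (hN : 0 < N) (m α : ℝ) (W : ℝ → ℝ)
    (hW : ContDiff ℝ 2 W) :
    (∀ u : Pt N → ℝ, ContDiff ℝ 2 u → ZPeriodic u → (∫ x in cube N, u x) = 0 →
        0 ≤ ∫ x in cube N, ((α * u x + lap u x)^2 + iteratedDeriv 2 W m * (u x)^2)) ↔
      0 ≤ iteratedDeriv 2 W m + freqMinPFC N α := by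
  constructor
  · intro H
    suffices -iteratedDeriv 2 W m ≤ freqMinPFC N α by linarith
    apply le_csInf
    · refine ⟨_, fun _ => 1, ?_, rfl⟩
      intro h
      have := congrFun h ⟨0, hN⟩
      simp at this
    · rintro t ⟨k, hk, rfl⟩
      have h := H (cosk k) (cosk_contDiff k) (cosk_per k) (integral_cosk hk)
      rw [energy_split (cosk_contDiff k)] at h
      have e : ∀ x, (α * cosk k x + lap (cosk k) x) ^ 2 =
          (α - 4*π^2 * ∑ i, ((k i : ℝ))^2)^2 * cosk k x ^ 2 := by
        intro x
        rw [lap_cosk]; ring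
      simp only [e] at h
      rw [integral_const_mul, integral_cosk_sq hk] at h
      linarith
  · intro H u hu hp h0
    rw [energy_split hu]
    have h1 := backward hu hp h0 α
    have h2 : 0 ≤ ∫ x in cube N, (u x)^2 := integral_nonneg fun x => sq_nonneg _
    nlinarith [mul_nonneg H h2]

end
end

section
/- (Theorem 3.2, part 3) Let m, α ∈ ℝ and W ∈ C⁴(ℝ) with W''''(t) = w² for all t ∈ ℝ, for some constant w > 0. Assume N < 12 and the strict inequality W''(m) + min_{k ∈ 2πℤ^N, k ≠ 0} (α − |k|²)² > 0. If P_N < (W'''(m))² / (3w²), then m is not a global minimizer of 𝓕 over H²_m(𝕋^N): there exists φ ∈ H²_m(𝕋^N) with 𝓕(φ) < 𝓕(m). -/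
open MeasureTheory Filter Real

noncomputable section

lemma hda_congr {f g : ℝ → ℝ} {f' g' x : ℝ} (h : HasDerivAt f f' x) (h1 : ∀ y, g y = f y)
    (h2 : g' = f') : HasDerivAt g g' x := by
  have : g = f := funext h1
  rw [this, h2]; exact h

lemma aux_eq {f g f' g' : ℝ → ℝ} (m : ℝ) (hf : ∀ x, HasDerivAt f (f' x) x)
    (hg : ∀ x, HasDerivAt g (g' x) x) (h : ∀ x, f' x = g' x) (hm : f m = g m) :
    ∀ x, f x = g x := by
  intro x
  have hd : ∀ y, HasDerivAt (fun y => f y - g y) 0 y := by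
    intro y
    have := (hf y).sub (hg y)
    rw [h y, sub_self] at this
    exact this
  have := is_const_of_deriv_eq_zero (fun y => (hd y).differentiableAt) (fun y => (hd y).deriv) x m
  simp only [hm, sub_self] at this
  linarith

lemma taylor_W (W : ℝ → ℝ) (m w : ℝ) (hW : ContDiff ℝ 4 W)
    (hW4 : ∀ t : ℝ, iteratedDeriv 4 W t = w^2) (x : ℝ) :
    W x = W m + iteratedDeriv 1 W m * (x - m) + iteratedDeriv 2 W m / 2 * (x - m)^2
      + iteratedDeriv 3 W m / 6 * (x - m)^3 + w^2 / 24 * (x - m)^4 := by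
  have hd : ∀ n : ℕ, n < 4 → ∀ y, HasDerivAt (iteratedDeriv n W) (iteratedDeriv (n+1) W y) y := by
    intro n hn y
    rw [iteratedDeriv_succ]
    exact ((hW.differentiable_iteratedDeriv n (by exact_mod_cast hn)) y).hasDerivAt
  have hp : ∀ (n : ℕ) (y : ℝ), HasDerivAt (fun y => (y - m)^(n+1)) ((n+1) * (y-m)^n) y := by
    intro n y
    have := ((hasDerivAt_id y).sub_const m).pow (n+1)
    exact hda_congr this (fun y => by simp) (by simp)
  have h3 : ∀ y, iteratedDeriv 3 W y = iteratedDeriv 3 W m + w^2 * (y - m) := by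
    refine aux_eq m (hd 3 (by norm_num)) (g' := fun _ => w^2) ?_ (fun y => hW4 y) (by simp)
    intro y
    have := ((hp 0 y).const_mul (w^2)).const_add (iteratedDeriv 3 W m)
    simpa using this
  have h2 : ∀ y, iteratedDeriv 2 W y = iteratedDeriv 2 W m + iteratedDeriv 3 W m * (y - m)
      + w^2 / 2 * (y - m)^2 := by
    refine aux_eq m (hd 2 (by norm_num)) (g' := fun y => iteratedDeriv 3 W m + w^2 * (y - m))
      ?_ h3 (by simp)
    intro y
    have := (((hp 0 y).const_mul (iteratedDeriv 3 W m)).const_add (iteratedDeriv 2 W m)).add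
      ((hp 1 y).const_mul (w^2/2))
    exact hda_congr this (fun z => by simp) (by push_cast; ring)
  have h1 : ∀ y, iteratedDeriv 1 W y = iteratedDeriv 1 W m + iteratedDeriv 2 W m * (y - m)
      + iteratedDeriv 3 W m / 2 * (y - m)^2 + w^2 / 6 * (y - m)^3 := by
    refine aux_eq m (hd 1 (by norm_num)) (g' := fun y => iteratedDeriv 2 W m
      + iteratedDeriv 3 W m * (y - m) + w^2 / 2 * (y - m)^2) ?_ h2 (by simp)
    intro y
    have := ((((hp 0 y).const_mul (iteratedDeriv 2 W m)).const_add (iteratedDeriv 1 W m)).add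
      ((hp 1 y).const_mul (iteratedDeriv 3 W m / 2))).add ((hp 2 y).const_mul (w^2/6))
    exact hda_congr this (fun z => by simp) (by push_cast; ring)
  have h0' : ∀ y, HasDerivAt W (iteratedDeriv 1 W y) y := by
    intro y
    have := hd 0 (by norm_num) y
    rwa [iteratedDeriv_zero] at this
  refine aux_eq m h0' (g := fun x => W m + iteratedDeriv 1 W m * (x - m)
      + iteratedDeriv 2 W m / 2 * (x - m)^2
      + iteratedDeriv 3 W m / 6 * (x - m)^3 + w^2 / 24 * (x - m)^4) (g' := fun y => iteratedDeriv 1 W m + iteratedDeriv 2 W m * (y - m)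
      + iteratedDeriv 3 W m / 2 * (y - m)^2 + w^2 / 6 * (y - m)^3) ?_ h1 (by simp) x
  intro y
  have := (((((hp 0 y).const_mul (iteratedDeriv 1 W m)).const_add (W m)).add
      ((hp 1 y).const_mul (iteratedDeriv 2 W m / 2))).add
      ((hp 2 y).const_mul (iteratedDeriv 3 W m / 6))).add ((hp 3 y).const_mul (w^2/24))
  exact hda_congr this (fun z => by simp) (by push_cast; ring)

lemma contDiff_pd {N : ℕ} (i : Fin N) {u : Pt N → ℝ} {n : ℕ} (hu : ContDiff ℝ (n+1) u) :
    ContDiff ℝ n (pd i u) := by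
  unfold pd
  exact (hu.fderiv_right le_rfl).clm_apply contDiff_const

lemma continuous_lap {N : ℕ} {u : Pt N → ℝ} (hu : ContDiff ℝ 2 u) : Continuous (lap u) := by
  unfold lap pd2
  refine continuous_finsetSum _ fun i _ => ?_
  have h1 : ContDiff ℝ ((1:ℕ):WithTop ℕ∞) (pd i u) := contDiff_pd i (by exact_mod_cast hu)
  have h2 : ContDiff ℝ ((0:ℕ):WithTop ℕ∞) (pd i (pd i u)) := contDiff_pd i (by exact_mod_cast h1)
  exact h2.continuous

lemma pd_periodic {N : ℕ} (i : Fin N) {u : Pt N → ℝ} (hu : ZPeriodic u) : ZPeriodic (pd i u) := by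
  intro x j
  unfold pd
  rw [← fderiv_comp_add_right]
  congr 2
  ext y
  exact hu y j

lemma integral_lap {N : ℕ} (hN : 0 < N) {u : Pt N → ℝ} (hu : ContDiff ℝ 2 u) (hp : ZPeriodic u) :
    ∫ x in cube N, lap u x = 0 := by
  obtain ⟨n, rfl⟩ : ∃ n, N = n + 1 := ⟨N - 1, by omega⟩
  have h1 : ∀ i, ContDiff ℝ ((1:ℕ):WithTop ℕ∞) (pd i u) :=
    fun i => contDiff_pd i (by exact_mod_cast hu)
  have key := integral_divergence_of_hasFDerivAt_off_countable' (n := n) (E := ℝ)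
    (a := 0) (b := 1) (by intro i; simp) (fun i => pd i u) (fun i => fderiv ℝ (pd i u)) ∅
    Set.countable_empty (fun i => (h1 i).continuous.continuousOn)
    (fun x _ i => ((h1 i).differentiable (by norm_num) x).hasFDerivAt)
    ((continuous_lap hu).integrableOn_Icc)
  have : ∫ x in cube (n+1), lap u x = _ := key
  rw [this]
  refine Finset.sum_eq_zero fun i _ => ?_
  rw [sub_eq_zero]
  congr 1
  ext y
  have : (Fin.insertNth i ((1 : Pt (n+1)) i) y : Pt (n+1))
      = (Fin.insertNth i ((0 : Pt (n+1)) i) y : Pt (n+1)) + Pi.single i 1 := by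
    rw [Fin.insertNth_eq_iff]
    constructor
    · simp
    · ext j; simp [Fin.removeNth]
  rw [this]
  exact pd_periodic i hp _ i

lemma volume_cube (N : ℕ) : volume.real (cube N) = 1 := by
  simp [cube, Measure.real, Real.volume_Icc_pi]

lemma lap_affine {N : ℕ} {u : Pt N → ℝ} (hu : ContDiff ℝ 2 u) (m t : ℝ) (x : Pt N) :
    lap (fun y => m + t * u y) x = t * lap u x := by
  have h1 : ∀ i, ContDiff ℝ ((1:ℕ):WithTop ℕ∞) (pd i u) :=
    fun i => contDiff_pd i (by exact_mod_cast hu)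
  have e1 : ∀ i, pd i (fun y => m + t * u y) = fun y => t * pd i u y := by
    intro i
    ext y
    unfold pd
    rw [fderiv_const_add, fderiv_const_mul ((hu.differentiable (by norm_num)) y)]
    simp
  unfold lap pd2
  rw [Finset.mul_sum]
  refine Finset.sum_congr rfl fun i _ => ?_
  rw [e1]
  change fderiv ℝ (fun y => t * pd i u y) x _ = t * fderiv ℝ (pd i u) x _
  rw [fderiv_const_mul (((h1 i).differentiable (by norm_num)) x)]
  simp

lemma int_cube_coord {N : ℕ} (i : Fin N) (g : ℝ → ℝ) (hg : Continuous g) :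
    ∫ x in cube N, g (x i) = ∫ s in (0:ℝ)..1, g s := by
  have hc : cube N = Set.pi Set.univ (fun _ => Set.Icc (0:ℝ) 1) := by
    ext x; simp [cube, Set.mem_pi, Pi.le_def, forall_and]
  rw [hc, volume_pi, Measure.restrict_pi_pi, intervalIntegral.integral_of_le zero_le_one,
    ← integral_Icc_eq_integral_Ioc]
  have : IsProbabilityMeasure ((volume : Measure ℝ).restrict (Set.Icc 0 1)) := ⟨by simp⟩
  have mp := measurePreserving_eval (fun _ : Fin N => (volume : Measure ℝ).restrict (Set.Icc 0 1)) i
  conv_rhs => rw [← mp.map_eq]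
  rw [integral_map mp.measurable.aemeasurable hg.aestronglyMeasurable]

/-- one-dimensional profile -/
def prof (s : ℝ) : ℝ := cos (2*π*s) + cos (2*(2*π*s))

lemma prof_int : ∫ s in (0:ℝ)..1, prof s = 0 := by
  have hd : ∀ s ∈ Set.uIcc (0:ℝ) 1, HasDerivAt
      (fun s => (sin (2*π*s) + sin (2*(2*π*s)) / 2) / (2*π)) (prof s) s := by
    intro s _
    have l1 : HasDerivAt (fun s : ℝ => 2*π*s) (2*π) s := by
      simpa using (hasDerivAt_id s).const_mul (2*π)
    have := (l1.sin.add ((l1.const_mul 2).sin.div_const 2)).div_const (2*π)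
    refine hda_congr this (fun y => by simp) ?_
    unfold prof
    field_simp
  rw [intervalIntegral.integral_eq_sub_of_hasDerivAt hd
    (Continuous.intervalIntegrable (by unfold prof; fun_prop) _ _)]
  have e2 : sin (2*(2*π*1)) = 0 := by
    have := sin_nat_mul_pi 4; push_cast at this; rw [← this]; ring_nf
  have e1 : sin (2*π*1) = 0 := by simp
  rw [e1, e2]; simp

lemma prof_int3 : ∫ s in (0:ℝ)..1, prof s ^ 3 = 3/4 := by
  have hd : ∀ s ∈ Set.uIcc (0:ℝ) 1, HasDerivAt
      (fun s => ((sin (2*π*s) - sin (2*π*s)^3/3) + 3/4 * sin (2*(2*π*s)) + 3/4 * (2*π*s)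
        + 3/16 * sin (2*(2*(2*π*s)))
        + 3 * (sin (2*π*s) - 4/3 * sin (2*π*s)^3 + 4/5 * sin (2*π*s)^5)
        + (sin (2*(2*π*s)) - sin (2*(2*π*s))^3/3)/2) / (2*π)) (prof s ^ 3) s := by
    intro s _
    have l1 : HasDerivAt (fun s : ℝ => 2*π*s) (2*π) s := by
      simpa using (hasDerivAt_id s).const_mul (2*π)
    have l2 := l1.const_mul 2
    have l4 := l2.const_mul 2
    have := ((((((l1.sin.sub ((l1.sin.pow 3).div_const 3)).add (l2.sin.const_mul (3/4))).add
      (l1.const_mul (3/4))).add (l4.sin.const_mul (3/16))).add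
      (((l1.sin.sub ((l1.sin.pow 3).const_mul (4/3))).add
        ((l1.sin.pow 5).const_mul (4/5))).const_mul 3)).add
      ((l2.sin.sub ((l2.sin.pow 3).div_const 3)).div_const 2)).div_const (2*π)
    refine hda_congr this (fun y => by simp) ?_
    unfold prof
    have q1 := sin_sq_add_cos_sq (2*π*s)
    have q2 := sin_sq_add_cos_sq (2*(2*π*s))
    have q4 := cos_two_mul (2*(2*π*s))
    have q3 := cos_two_mul (2*π*s)
    rw [q4]
    generalize hS : sin (2*(2*π*s)) = S at *
    generalize hC : cos (2*(2*π*s)) = C at *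
    generalize sin (2*π*s) = z at *
    generalize cos (2*π*s) = c at *
    have hz : z^2 = 1 - c^2 := by linarith
    have hS2 : S^2 = 1 - C^2 := by linarith
    have hz4 : z^4 = (1 - c^2)^2 := by rw [← hz]; ring
    field_simp
    simp only [Nat.cast_ofNat, Nat.reduceSub, hz, hS2, hz4, q3]
    ring
  rw [intervalIntegral.integral_eq_sub_of_hasDerivAt hd
    (Continuous.intervalIntegrable (by unfold prof; fun_prop) _ _)]
  have e2 : sin (2*(2*π*1)) = 0 := by
    have := sin_nat_mul_pi 4; push_cast at this; rw [← this]; ring_nf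
  have e4 : sin (2*(2*(2*π*1))) = 0 := by
    have := sin_nat_mul_pi 8; push_cast at this; rw [← this]; ring_nf
  have e1 : sin (2*π*1) = 0 := by simp
  rw [e1, e2, e4]; simp

lemma prof_periodic (s : ℝ) : prof (s + 1) = prof s := by
  unfold prof
  have h1 : cos (2*π*(s+1)) = cos (2*π*s) := by rw [← cos_add_two_pi (2*π*s)]; ring_nf
  have h2 : cos (2*(2*π*(s+1))) = cos (2*(2*π*s)) := by rw [cos_two_mul, h1, ← cos_two_mul]
  rw [h1, h2]

lemma exists_admissible {N : ℕ} (hN : 0 < N) : ∃ u : Pt N → ℝ, AdmissibleP u := by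
  have hcp : Continuous prof := by unfold prof; fun_prop
  set a : ℝ := ((4:ℝ)/3) ^ ((1:ℝ)/3) with ha
  have ha3 : a^3 = 4/3 := by
    rw [ha, ← rpow_natCast, ← rpow_mul (by norm_num)]; norm_num
  refine ⟨fun x => a * prof (x ⟨0, hN⟩), ?_, ?_, ?_, ?_⟩
  · unfold prof; fun_prop
  · intro x i
    by_cases hi : i = ⟨0, hN⟩
    · subst hi; simp [prof_periodic]
    · simp [Pi.single_apply, Ne.symm hi]
  · rw [int_cube_coord ⟨0, hN⟩ (fun s => (a * prof s)^3) (by fun_prop)]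
    simp only [mul_pow]
    rw [intervalIntegral.integral_const_mul, prof_int3, ha3]; norm_num
  · rw [int_cube_coord ⟨0, hN⟩ (fun s => (a * prof s)) (by fun_prop),
      intervalIntegral.integral_const_mul, prof_int, mul_zero]

lemma exists_t (A B d w : ℝ) (hw : 0 < w) (hB : 0 < B) (h : A * B < d^2 / (3 * w^2)) :
    ∃ t : ℝ, t^2 * A / 2 + d / 6 * t^3 + w^2 / 24 * t^4 * B < 0 := by
  rw [lt_div_iff₀ (by positivity)] at h
  have hw2 : 0 < w^2 := by positivity
  by_cases hd : d = 0
  · subst hd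
    have hA : A < 0 := by
      by_contra hA
      push Not at hA
      have : 0 ≤ A * B * (3 * w^2) := by positivity
      linarith
    have hpos : 0 < -6*A/(w^2*B) := div_pos (by linarith) (by positivity)
    refine ⟨√(-6*A/(w^2*B)), ?_⟩
    have hs := sq_sqrt hpos.le
    set s := √(-6*A/(w^2*B))
    have e : w^2 * B * s^2 = -6*A := by rw [hs]; field_simp
    have : s^2 * A / 2 + 0 / 6 * s^3 + w^2/24*s^4*B = s^2 * A / 4 := by
      linear_combination s^2/24 * e
    rw [this]
    have : 0 < s^2 := by rw [hs]; exact hpos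
    nlinarith
  · refine ⟨-2*d/(w^2*B), ?_⟩
    set t := -2*d/(w^2*B) with ht
    have e : w^2 * B * t = -2*d := by rw [ht]; field_simp
    have ht0 : t ≠ 0 := by rw [ht]; exact div_ne_zero (by simpa using hd) (by positivity)
    clear_value t
    have : (t^2 * A / 2 + d / 6 * t^3 + w^2/24*t^4*B) * (6 * w^2 * B)
        = t^2 * (A * B * (3*w^2) - d^2) := by
      linear_combination t^2/4 * (w^2*B*t + 2*d) * e
    have h2 : t^2 * (A * B * (3*w^2) - d^2) < 0 :=
      mul_neg_of_pos_of_neg (by positivity) (by linarith)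
    rw [← this] at h2
    by_contra hc
    push Not at hc
    have : 0 ≤ (t^2 * A / 2 + d / 6 * t^3 + w^2/24*t^4*B) * (6 * w^2 * B) := by positivity
    linarith

lemma Fen_diff {N : ℕ} (hN : 0 < N) (m α w : ℝ) (W : ℝ → ℝ) (hW : ContDiff ℝ 4 W)
    (hW4 : ∀ t : ℝ, iteratedDeriv 4 W t = w^2) {u : Pt N → ℝ} (hu : AdmissibleP u) (t : ℝ) :
    Fen α W (fun x => m + t * u x) = Fen α W (fun _ : Pt N => m) +
      (t^2 * (∫ x in cube N, ((α * u x + lap u x)^2 + iteratedDeriv 2 W m * (u x)^2)) / 2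
      + iteratedDeriv 3 W m / 6 * t^3 + w^2 / 24 * t^4 * (∫ x in cube N, (u x)^4)) := by
  obtain ⟨hu2, hup, hu3, hu1⟩ := hu
  have cu := hu2.continuous
  have cl := continuous_lap hu2
  have hlap0 : ∀ x, lap (fun _ : Pt N => m) x = 0 := by
    intro x; simpa using lap_affine hu2 m 0 x
  have I : ∀ {f : Pt N → ℝ}, Continuous f → IntegrableOn f (cube N) :=
    fun hf => hf.integrableOn_Icc
  have e0 : Fen α W (fun _ : Pt N => m) = 1/2 * (α*m)^2 + W m := by
    unfold Fen
    simp [hlap0, volume_cube]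
  have e1 : Fen α W (fun x => m + t * u x) = ∫ x in cube N,
      ((1/2 * (α*m)^2 + W m) + ((α^2*m*t + iteratedDeriv 1 W m * t) * u x
        + ((α*m*t) * lap u x
        + ((t^2/2) * ((α * u x + lap u x)^2 + iteratedDeriv 2 W m * (u x)^2)
        + ((iteratedDeriv 3 W m / 6 * t^3) * (u x)^3 + (w^2/24*t^4) * (u x)^4))))) := by
    unfold Fen
    congr 1
    ext x
    rw [lap_affine hu2, taylor_W W m w hW hW4 (m + t * u x)]
    ring
  rw [e1, e0]
  generalize 1/2 * (α*m)^2 + W m = K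
  rw [integral_add (I (by fun_prop)) (I (by fun_prop)),
    integral_add (I (by fun_prop)) (I (by fun_prop)),
    integral_add (I (by fun_prop)) (I (by fun_prop)),
    integral_add (I (by fun_prop)) (I (by fun_prop)),
    integral_add (I (by fun_prop)) (I (by fun_prop))]
  simp only [integral_const_mul]
  rw [hu1, hu3, integral_lap hN hu2 hup]
  simp [volume_cube]
  ring

/-- Theorem 3.2, part 3: failure of global minimality when P_N is below the threshold. -/
theorem uniform_state_not_global_min (N : ℕ) (hN : 0 < N) (hN12 : N < 12)
    (m α w : ℝ) (W : ℝ → ℝ) (hw : 0 < w) (hW : ContDiff ℝ 4 W)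
    (hW4 : ∀ t : ℝ, iteratedDeriv 4 W t = w^2)
    (hstab : 0 < iteratedDeriv 2 W m + freqMinPFC N α)
    (hP : PN N α (iteratedDeriv 2 W m) < (iteratedDeriv 3 W m)^2 / (3 * w^2)) :
    ∃ φ : Pt N → ℝ, MemH2m m φ ∧ Fen α W φ < Fen α W (fun _ : Pt N => m) := by
  obtain ⟨u0, hu0⟩ := exists_admissible hN
  obtain ⟨p, ⟨u, hu, rfl⟩, hlt⟩ := exists_lt_of_csInf_lt
    (s := {p : ℝ | ∃ u : Pt N → ℝ, AdmissibleP u ∧ p = Penergy α (iteratedDeriv 2 W m) u})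
    ⟨_, u0, hu0, rfl⟩ hP
  have cu := hu.1.continuous
  have I : ∀ {f : Pt N → ℝ}, Continuous f → IntegrableOn f (cube N) :=
    fun hf => hf.integrableOn_Icc
  have hB : 0 < ∫ x in cube N, (u x)^4 := by
    have h1 : ∫ x in cube N, (u x)^3 ≤ ∫ x in cube N, ((u x)^4 + 1/2) := by
      refine integral_mono ?_ ?_ ?_
      · exact (show Continuous fun x => (u x)^3 by fun_prop).integrableOn_Icc
      · exact (show Continuous fun x => (u x)^4 + 1/2 by fun_prop).integrableOn_Icc
      · intro x
        simp only
        nlinarith [sq_nonneg (u x ^2 - u x / 2 - 1/4), sq_nonneg (u x - 1/2), sq_nonneg (u x)]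
    rw [integral_add (I (by fun_prop)) (I (by fun_prop)), hu.2.2.1] at h1
    simp [volume_cube] at h1
    linarith
  obtain ⟨t, ht⟩ := exists_t _ _ _ w hw hB hlt
  refine ⟨fun x => m + t * u x, ⟨?_, ?_, ?_⟩, ?_⟩
  · have := hu.1; fun_prop
  · intro x i; simp only [hu.2.1 x i]
  · rw [integral_add (I (by fun_prop)) (I (by fun_prop)),
      integral_const_mul, hu.2.2.2]
    simp [volume_cube]
  · rw [Fen_diff hN m α w W hW hW4 hu t]
    linarith

end
end
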